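/- arXiv:2509.16162 — 2 statements merged into one kernel-verified Lean document; each statement's English description precedes it below -/
import Mathlib

section
/- Let (U_e)_{e∈𝓔} be i.i.d. Uniform[0,1] random variables indexed by the nearest-neighbour edges 𝓔 of ℤ^d, d ≥ 2, with product law ℙ. Then, with probability 1, the coordinates (U_e)_{e∈𝓔} are pairwise distinct and there is no infinite walk x_1, x_2, … in ℤ^d (consecutive vertices joined by edges of 𝓔) such that the sequence i ↦ U_{x_i x_{i+1}} is strictly monotone. In other words, ℙ(Ω) = 1 where Ω is the set of such configurations. -/
open MeasureTheory

namespace CDP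

/-- Vertices of the hypercubic lattice `ℤ^d`. -/
abbrev Vertex (d : ℕ) := Fin d → ℤ

/-- Nearest-neighbour adjacency in `ℤ^d`. -/
def adj {d : ℕ} (x y : Vertex d) : Prop := (∑ i, |x i - y i|) = 1

/-- `e` is a nearest-neighbour (non-oriented) edge of `ℤ^d`, i.e. an element of `𝓔`. -/
def IsNNEdge {d : ℕ} (e : Sym2 (Vertex d)) : Prop := ∃ x y, adj x y ∧ e = s(x, y)

/-- Configurations: labels attached to (unordered) pairs of vertices; only the labels of
nearest-neighbour edges (elements of `𝓔`) are ever relevant. -/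
abbrev Config (d : ℕ) := Sym2 (Vertex d) → ℝ

/-- `ℓ^1` norm of a vertex. -/
def norm1 {d : ℕ} (x : Vertex d) : ℤ := ∑ i, |x i|

/-- The set `Ω`: configurations with values in `[0,1]`, pairwise distinct coordinates on `𝓔`,
and no infinite walk along which the labels are strictly monotone. -/
def goodConfigs (d : ℕ) : Set (Config d) :=
  {U | (∀ e, IsNNEdge e → U e ∈ Set.Icc (0 : ℝ) 1) ∧
    (∀ e f, IsNNEdge e → IsNNEdge f → U e = U f → e = f) ∧
    ¬ ∃ w : ℕ → Vertex d, (∀ i, adj (w i) (w (i + 1))) ∧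
      (StrictMono (fun i => U s(w i, w (i + 1))) ∨ StrictAnti (fun i => U s(w i, w (i + 1))))}

/-- A labelling `σ` of the edges by "ever opens" which is consistent with the
constrained-degree dynamics driven by `U`: an edge (attempting to open at time `U e`)
opens iff at that moment both of its end-vertices have degree `< κ` among the
previously opened edges. -/
def Consistent {d : ℕ} (κ : ℕ) (U : Config d) (σ : Sym2 (Vertex d) → Prop) : Prop :=
  ∀ e, IsNNEdge e →
    (σ e ↔ ∀ v ∈ e,
      Set.ncard {f : Sym2 (Vertex d) | IsNNEdge f ∧ v ∈ f ∧ f ≠ e ∧ U f < U e ∧ σ f} < κ)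

/-- `ω_p(U, e) = 1`, i.e. the edge `e` is `p`-open in the constrained-degree percolation
process with constraint `κ` driven by `U`. -/
def openEdge {d : ℕ} (κ : ℕ) (U : Config d) (p : ℝ) (e : Sym2 (Vertex d)) : Prop :=
  IsNNEdge e ∧ U e ≤ p ∧ ∃ σ, Consistent κ U σ ∧ σ e

/-- `x 0, …, x k` is a path: consecutive vertices adjacent, all vertices distinct. -/
def IsPathOn {d : ℕ} (k : ℕ) (x : ℕ → Vertex d) : Prop :=
  (∀ i < k, adj (x i) (x (i + 1))) ∧ ∀ i ≤ k, ∀ j ≤ k, x i = x j → i = j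

/-- The modified one-arm event `E_n(p)`: a path `x_0, …, x_k` with `‖x_0‖₁ = n`,
`‖x_i‖₁ < n` for `1 ≤ i ≤ k`, `x_k = 0`, whose head consists of `p`-open edges and whose
tail is decreasing (values `≤ p`, strictly decreasing towards the origin). -/
def modifiedOneArm {d : ℕ} (κ n : ℕ) (p : ℝ) (U : Config d) : Prop :=
  ∃ (k : ℕ) (x : ℕ → Vertex d),
    IsPathOn k x ∧ norm1 (x 0) = (n : ℤ) ∧ (∀ i, 1 ≤ i → i ≤ k → norm1 (x i) < (n : ℤ)) ∧
    x k = 0 ∧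
    ∃ l ≤ k,
      (∀ i < l, openEdge κ U p s(x i, x (i + 1))) ∧
      (∀ i, l ≤ i → i < k → U s(x i, x (i + 1)) ≤ p) ∧
      (∀ i, l ≤ i → i + 1 < k → U s(x (i + 1), x (i + 2)) < U s(x i, x (i + 1)))

/-- `a` and `b` are connected by a `p`-open path. -/
def openConn {d : ℕ} (κ : ℕ) (U : Config d) (p : ℝ) (a b : Vertex d) : Prop :=
  ∃ (k : ℕ) (x : ℕ → Vertex d), IsPathOn k x ∧ x 0 = a ∧ x k = b ∧
    ∀ i < k, openEdge κ U p s(x i, x (i + 1))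

/-- There is an infinite `p`-open path starting at the origin. -/
def zeroToInf {d : ℕ} (κ : ℕ) (U : Config d) (p : ℝ) : Prop :=
  ∃ x : ℕ → Vertex d, x 0 = 0 ∧ (∀ i, adj (x i) (x (i + 1))) ∧ Function.Injective x ∧
    ∀ i, openEdge κ U p s(x i, x (i + 1))

/-- `P` is the law of i.i.d. `Uniform[0,1]` labels: a probability measure whose
finite-dimensional cylinder probabilities are products of uniform probabilities. -/
def IsProductUniform {d : ℕ} (P : Measure (Config d)) : Prop :=
  IsProbabilityMeasure P ∧
    ∀ (s : Finset (Sym2 (Vertex d))) (f : Sym2 (Vertex d) → Set ℝ),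
      (∀ e ∈ s, MeasurableSet (f e)) →
      P {U | ∀ e ∈ s, U e ∈ f e} = ∏ e ∈ s, volume (f e ∩ Set.Icc 0 1)

/-- The one-arm probability `θ_n(p)`. -/
noncomputable def theta {d : ℕ} (κ : ℕ) (P : Measure (Config d)) (n : ℕ) (p : ℝ) : ℝ :=
  (P {U | U ∈ goodConfigs d ∧ ∃ b, norm1 b = (n : ℤ) ∧ openConn κ U p 0 b}).toReal

/-- `θ(p) = ℙ(0 ↔ ∞)`. -/
noncomputable def thetaInf {d : ℕ} (κ : ℕ) (P : Measure (Config d)) (p : ℝ) : ℝ :=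
  (P {U | U ∈ goodConfigs d ∧ zeroToInf κ U p}).toReal

/-- The critical point `p_c`. -/
noncomputable def pc {d : ℕ} (κ : ℕ) (P : Measure (Config d)) : ℝ :=
  sSup {p : ℝ | p ∈ Set.Icc (0 : ℝ) 1 ∧ thetaInf κ P p = 0}

/-- The modified one-arm probability `τ_n(p)`. -/
noncomputable def tau {d : ℕ} (κ : ℕ) (P : Measure (Config d)) (n : ℕ) (p : ℝ) : ℝ :=
  (P {U | U ∈ goodConfigs d ∧ modifiedOneArm κ n p U}).toReal

/-- `e` is `p`-pivotal for `E_n(p)` at `U`. -/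
def pPivotal {d : ℕ} (κ n : ℕ) (p : ℝ) (e : Sym2 (Vertex d)) (U : Config d) : Prop :=
  U ∈ goodConfigs d ∧ p < U e ∧ Function.update U e p ∈ goodConfigs d ∧
    ¬ (modifiedOneArm κ n p U ↔ modifiedOneArm κ n p (Function.update U e p))

/-- `e` is `U`-pivotal for `E_n(p)` at `U`. -/
def uPivotal {d : ℕ} (κ n : ℕ) (p : ℝ) (e : Sym2 (Vertex d)) (U : Config d) : Prop :=
  U ∈ goodConfigs d ∧ ∃ U' ∈ goodConfigs d, (∀ f, f ≠ e → U' f = U f) ∧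
    ¬ (modifiedOneArm κ n p U ↔ modifiedOneArm κ n p U')

/-- A monotone integer sequence that is bounded above is eventually constant. -/
lemma exists_eventually_const_of_monotone {g : ℕ → ℤ} (hg : Monotone g) {b : ℤ}
    (hb : ∀ i, g i ≤ b) : ∃ N k, ∀ i, g (N + i) = k := by
  obtain ⟨k, ⟨N, hN⟩, hk⟩ := Int.exists_greatest_of_bdd (P := fun z => ∃ i, g i = z)
    ⟨b, by rintro z ⟨i, rfl⟩; exact hb i⟩ ⟨g 0, 0, rfl⟩
  refine ⟨N, k, fun i => le_antisymm (hk _ ⟨_, rfl⟩) ?_⟩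
  rw [← hN]
  exact hg (Nat.le_add_right N i)

/-- An antitone integer sequence that is bounded below is eventually constant. -/
lemma exists_eventually_const_of_antitone {g : ℕ → ℤ} (hg : Antitone g) {b : ℤ}
    (hb : ∀ i, b ≤ g i) : ∃ N k, ∀ i, g (N + i) = k := by
  obtain ⟨N, k, h⟩ := exists_eventually_const_of_monotone (g := fun i => -g i)
    (fun i j hij => neg_le_neg (hg hij)) (b := -b) (fun i => neg_le_neg (hb i))
  exact ⟨N, -k, fun i => by rw [← h i, neg_neg]⟩

/-- The cell of the grid of mesh `1 / m` with index `k`. -/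
def gridCell (m : ℕ) (k : ℤ) : Set ℝ := {x | ⌊(m : ℝ) * x⌋ = k}

lemma measurableSet_gridCell (m : ℕ) (k : ℤ) : MeasurableSet (gridCell m k) := by
  have h : Measurable fun x : ℝ => ⌊(m : ℝ) * x⌋ :=
    Int.measurable_floor.comp (measurable_const_mul _)
  exact h (measurableSet_singleton k)

lemma volume_gridCell_le {m : ℕ} (hm : 0 < m) (k : ℤ) :
    volume (gridCell m k ∩ Set.Icc 0 1) ≤ (m : ENNReal)⁻¹ := by
  have hm' : (0 : ℝ) < m := by exact_mod_cast hm
  calc volume (gridCell m k ∩ Set.Icc 0 1)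
      ≤ volume (Set.Ico ((k : ℝ) / m) ((k + 1 : ℝ) / m)) := by
        refine measure_mono fun x hx => ?_
        have h := Int.floor_eq_iff.1 hx.1
        rw [Set.mem_Ico, div_le_iff₀ hm', lt_div_iff₀ hm', mul_comm x]
        exact h
    _ = ENNReal.ofReal (m : ℝ)⁻¹ := by
        rw [Real.volume_Ico]
        congr 1
        ring
    _ = (m : ENNReal)⁻¹ := by
        rw [ENNReal.ofReal_inv_of_pos hm', ENNReal.ofReal_natCast]

/-- The set of unit steps of the lattice. -/
def unitSteps (d : ℕ) : Set (Vertex d) := {z | ∑ i, |z i| = 1}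

lemma finite_unitSteps (d : ℕ) : (unitSteps d).Finite := by
  refine (Set.finite_Icc (-1 : Vertex d) 1).subset fun z hz => ?_
  have h : ∀ i, |z i| ≤ 1 := fun i =>
    (Finset.single_le_sum (fun j _ => abs_nonneg (z j)) (Finset.mem_univ i)).trans hz.le
  exact ⟨fun i => (abs_le.1 (h i)).1, fun i => (abs_le.1 (h i)).2⟩

section

variable {d : ℕ} {P : Measure (Config d)}

lemma IsProductUniform.measure_forall_mem_gridCell_le (hP : IsProductUniform P) {m : ℕ}
    (hm : 0 < m) (k : ℤ) (s : Finset (Sym2 (Vertex d))) :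
    P {U | ∀ e ∈ s, U e ∈ gridCell m k} ≤ (m : ENNReal)⁻¹ ^ s.card := by
  rw [hP.2 s (fun _ => gridCell m k) fun _ _ => measurableSet_gridCell m k]
  exact Finset.prod_le_pow_card _ _ _ fun _ _ => volume_gridCell_le hm k

lemma IsProductUniform.ae_mem_Icc (hP : IsProductUniform P) (e : Sym2 (Vertex d)) :
    ∀ᵐ U ∂P, U e ∈ Set.Icc (0 : ℝ) 1 := by
  have := hP.1
  have h := hP.2 {e} (fun _ => Set.Icc 0 1) fun _ _ => measurableSet_Icc
  simp only [Finset.mem_singleton, forall_eq, Finset.prod_singleton, Set.inter_self,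
    Real.volume_Icc, sub_zero, ENNReal.ofReal_one] at h
  have hmeas : MeasurableSet {U : Config d | U e ∈ Set.Icc (0 : ℝ) 1} :=
    measurable_pi_apply e measurableSet_Icc
  exact (mem_ae_iff_prob_eq_one hmeas).2 h

lemma floor_mem_Icc (m : ℕ) {x : ℝ} (hx : x ∈ Set.Icc (0 : ℝ) 1) :
    ⌊(m : ℝ) * x⌋ ∈ Set.Icc (0 : ℤ) m := by
  have hm : (0 : ℝ) ≤ m := Nat.cast_nonneg m
  refine ⟨Int.floor_nonneg.2 (mul_nonneg hm hx.1), ?_⟩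
  have h : (⌊(m : ℝ) * x⌋ : ℝ) ≤ m :=
    (Int.floor_le _).trans (mul_le_of_le_one_right hm hx.2)
  exact_mod_cast h

lemma IsProductUniform.ae_ne (hP : IsProductUniform P) {e f : Sym2 (Vertex d)} (hef : e ≠ f) :
    ∀ᵐ U ∂P, U e ≠ U f := by
  classical
  have key : ∀ᵐ U ∂P, ¬ (U e ∈ Set.Icc (0 : ℝ) 1 ∧ U e = U f) := by
    rw [ae_iff]
    simp only [not_not]
    have bound : ∀ m : ℕ, P {U | U e ∈ Set.Icc (0 : ℝ) 1 ∧ U e = U f} ≤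
        2 * ((m + 1 : ℕ) : ENNReal)⁻¹ := by
      intro m
      calc P {U | U e ∈ Set.Icc (0 : ℝ) 1 ∧ U e = U f}
          ≤ P (⋃ k ∈ Finset.Icc (0 : ℤ) (m + 1 : ℕ),
              {U | ∀ g ∈ ({e, f} : Finset _), U g ∈ gridCell (m + 1) k}) := by
            refine measure_mono fun U hU => ?_
            simp only [Set.mem_iUnion]
            refine ⟨⌊((m + 1 : ℕ) : ℝ) * U e⌋, Finset.mem_Icc.2 (floor_mem_Icc _ hU.1), ?_⟩
            simp [gridCell, hU.2]
        _ ≤ ∑ k ∈ Finset.Icc (0 : ℤ) (m + 1 : ℕ),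
              P {U | ∀ g ∈ ({e, f} : Finset _), U g ∈ gridCell (m + 1) k} :=
            measure_biUnion_finset_le _ _
        _ ≤ ∑ k ∈ Finset.Icc (0 : ℤ) (m + 1 : ℕ), ((m + 1 : ℕ) : ENNReal)⁻¹ ^ 2 := by
            refine Finset.sum_le_sum fun k _ => ?_
            rw [← Finset.card_pair hef]
            exact hP.measure_forall_mem_gridCell_le m.succ_pos k _
        _ = ((m + 2 : ℕ) : ENNReal) * ((m + 1 : ℕ) : ENNReal)⁻¹ ^ 2 := by
            rw [Finset.sum_const, Int.card_Icc, nsmul_eq_mul]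
            congr 2
        _ ≤ (2 * (m + 1 : ℕ) : ENNReal) * ((m + 1 : ℕ) : ENNReal)⁻¹ ^ 2 := by
            gcongr
            norm_cast
            omega
        _ = 2 * ((m + 1 : ℕ) : ENNReal)⁻¹ := by
            rw [sq, mul_assoc, ← mul_assoc ((m + 1 : ℕ) : ENNReal),
              ENNReal.mul_inv_cancel (by simp) (ENNReal.natCast_ne_top _), one_mul]
    have lim : Filter.Tendsto (fun m : ℕ => 2 * ((m + 1 : ℕ) : ENNReal)⁻¹) Filter.atTop
        (nhds 0) := by
      have h := ENNReal.Tendsto.const_mul (a := 2)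
        ((Filter.tendsto_add_atTop_iff_nat 1).2 ENNReal.tendsto_inv_nat_nhds_zero)
        (Or.inr (by simp))
      simpa using h
    exact le_antisymm (ge_of_tendsto' lim bound) zero_le
  filter_upwards [key, hP.ae_mem_Icc e] with U h he hU using h ⟨he, hU⟩

/-- `U` admits an infinite walk from `v` with distinct edges, all of whose labels lie in the
grid cell of index `k`. -/
def HasCellWalk (m : ℕ) (v : Vertex d) (k : ℤ) (U : Config d) : Prop :=
  ∃ w : ℕ → Vertex d, w 0 = v ∧ (∀ i, adj (w i) (w (i + 1))) ∧
    Function.Injective (fun i => s(w i, w (i + 1))) ∧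
    ∀ i, U s(w i, w (i + 1)) ∈ gridCell m k

/-- The position after `i` steps of the walk from `v` with steps `z`. -/
def walkFrom (v : Vertex d) {n : ℕ} (z : Fin n → unitSteps d) (i : ℕ) : Vertex d :=
  v + ∑ j : Fin n, if (j : ℕ) < i then (z j : Vertex d) else 0

lemma exists_walkFrom_eq {w : ℕ → Vertex d} (hw : ∀ i, adj (w i) (w (i + 1))) (n : ℕ) :
    ∃ z : Fin n → unitSteps d, ∀ i ≤ n, walkFrom (w 0) z i = w i := by
  have hz : ∀ i, w (i + 1) - w i ∈ unitSteps d := by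
    intro i
    have h := hw i
    unfold adj at h
    simpa [unitSteps, abs_sub_comm] using h
  refine ⟨fun j => ⟨w (j + 1) - w j, hz j⟩, fun i hi => ?_⟩
  unfold walkFrom
  rw [Fin.sum_univ_eq_sum_range (fun j => if j < i then w (j + 1) - w j else 0) n,
    ← Finset.sum_filter]
  have h : (Finset.range n).filter (· < i) = Finset.range i := by
    ext j
    simp only [Finset.mem_filter, Finset.mem_range]
    omega
  rw [h, Finset.sum_range_sub, add_sub_cancel]

lemma IsProductUniform.measure_hasCellWalk_le (hP : IsProductUniform P) {m : ℕ} (hm : 0 < m)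
    (v : Vertex d) (k : ℤ) (n : ℕ) :
    P {U | HasCellWalk m v k U} ≤ ((Nat.card (unitSteps d) : ENNReal) * (m : ENNReal)⁻¹) ^ n := by
  classical
  have : Fintype (unitSteps d) := (finite_unitSteps d).fintype
  let edge (z : Fin n → unitSteps d) (i : Fin n) : Sym2 (Vertex d) :=
    s(walkFrom v z i, walkFrom v z (i + 1))
  let A (z : Fin n → unitSteps d) : Set (Config d) :=
    {U | Function.Injective (edge z) ∧ ∀ i, U (edge z i) ∈ gridCell m k}
  have hA : ∀ z, P (A z) ≤ (m : ENNReal)⁻¹ ^ n := by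
    intro z
    by_cases hz : Function.Injective (edge z)
    · have hcard : (Finset.univ.image (edge z)).card = n := by
        rw [Finset.card_image_of_injective _ hz, Finset.card_univ, Fintype.card_fin]
      calc P (A z)
          ≤ P {U | ∀ e ∈ Finset.univ.image (edge z), U e ∈ gridCell m k} := by
            refine measure_mono fun U hU => ?_
            simpa using hU.2
        _ ≤ _ := hP.measure_forall_mem_gridCell_le hm k _
        _ = _ := by rw [hcard]
    · simp [A, hz]
  calc P {U | HasCellWalk m v k U}
      ≤ P (⋃ z ∈ (Finset.univ : Finset (Fin n → unitSteps d)), A z) := by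
        refine measure_mono fun U hU => ?_
        obtain ⟨w, rfl, hadj, hinj, hcell⟩ := hU
        obtain ⟨z, hz⟩ := exists_walkFrom_eq hadj n
        have hedge : ∀ i, edge z i = s(w i, w (i + 1)) := fun i => by
          simp only [edge, hz i i.2.le, hz (i + 1) i.2]
        simp only [Set.mem_iUnion]
        refine ⟨z, Finset.mem_univ z, fun i j hij => ?_, fun i => ?_⟩
        · rw [hedge, hedge] at hij
          exact Fin.ext (hinj hij)
        · rw [hedge]
          exact hcell i
    _ ≤ ∑ z : Fin n → unitSteps d, P (A z) := measure_biUnion_finset_le _ _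
    _ ≤ ∑ z : Fin n → unitSteps d, (m : ENNReal)⁻¹ ^ n := Finset.sum_le_sum fun z _ => hA z
    _ = _ := by
        rw [Finset.sum_const, Finset.card_univ, Fintype.card_fun, Fintype.card_fin,
          nsmul_eq_mul, mul_pow, Nat.card_eq_fintype_card, Nat.cast_pow]

lemma IsProductUniform.ae_not_hasCellWalk (hP : IsProductUniform P) {m : ℕ}
    (hm : Nat.card (unitSteps d) < m) (v : Vertex d) (k : ℤ) :
    ∀ᵐ U ∂P, ¬ HasCellWalk m v k U := by
  rw [ae_iff]
  simp only [not_not]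
  have hm0 : 0 < m := (Nat.zero_le _).trans_lt hm
  have hlt : (Nat.card (unitSteps d) : ENNReal) * (m : ENNReal)⁻¹ < 1 := by
    rw [← div_eq_mul_inv]
    refine ENNReal.div_lt_of_lt_mul ?_
    rw [one_mul]
    exact_mod_cast hm
  exact le_antisymm (ge_of_tendsto' (ENNReal.tendsto_pow_atTop_nhds_zero_of_lt_one hlt)
    (hP.measure_hasCellWalk_le hm0 v k)) zero_le

/-- A strictly monotone walk with labels in `[0,1]` has a tail with labels in one grid cell. -/
lemma exists_hasCellWalk {U : Config d} (m : ℕ)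
    (hU : ∀ e, IsNNEdge e → U e ∈ Set.Icc (0 : ℝ) 1) {w : ℕ → Vertex d}
    (hadj : ∀ i, adj (w i) (w (i + 1)))
    (hw : StrictMono (fun i => U s(w i, w (i + 1))) ∨
      StrictAnti (fun i => U s(w i, w (i + 1)))) :
    ∃ v k, HasCellWalk m v k U := by
  have hm : (0 : ℝ) ≤ m := Nat.cast_nonneg m
  have hfloor := fun i => floor_mem_Icc m (hU _ ⟨w i, w (i + 1), hadj i, rfl⟩)
  have hinj : Function.Injective (fun i => s(w i, w (i + 1))) :=
    Function.Injective.of_comp (f := U) (hw.elim StrictMono.injective StrictAnti.injective)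
  obtain ⟨N, k, hk⟩ : ∃ N k, ∀ i,
      ⌊(m : ℝ) * U s(w (N + i), w (N + i + 1))⌋ = k := by
    rcases hw with hw | hw
    · exact exists_eventually_const_of_monotone
        (g := fun i => ⌊(m : ℝ) * U s(w i, w (i + 1))⌋)
        (fun i j hij => Int.floor_mono (mul_le_mul_of_nonneg_left (hw.monotone hij) hm))
        fun i => (hfloor i).2
    · exact exists_eventually_const_of_antitone
        (g := fun i => ⌊(m : ℝ) * U s(w i, w (i + 1))⌋)
        (fun i j hij => Int.floor_mono (mul_le_mul_of_nonneg_left (hw.antitone hij) hm))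
        fun i => (hfloor i).1
  exact ⟨w N, k, fun i => w (N + i), rfl, fun i => hadj (N + i),
    hinj.comp (add_right_injective N), hk⟩

end

/-- With probability one, the coordinates `(U_e)_{e ∈ 𝓔}` are pairwise distinct and there is
no infinite walk along which the labels are strictly monotone: `ℙ(Ω) = 1`. -/
theorem good_configs_full_measure (d : ℕ) (hd : 2 ≤ d)
    (P : Measure (Config d)) (hP : IsProductUniform P) :
    P (goodConfigs d) = 1 := by
  have := hP.1
  have : Countable (Sym2 (Vertex d)) := Quotient.countable
  have hIcc : ∀ᵐ U ∂P, ∀ e, U e ∈ Set.Icc (0 : ℝ) 1 := ae_all_iff.2 hP.ae_mem_Icc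
  have hne : ∀ᵐ U ∂P, ∀ e f, e ≠ f → U e ≠ U f := by
    simp only [ae_all_iff]
    exact fun e f hef => hP.ae_ne hef
  have hwalk : ∀ᵐ U ∂P, ∀ v k, ¬ HasCellWalk (Nat.card (unitSteps d) + 1) v k U := by
    simp only [ae_all_iff]
    exact hP.ae_not_hasCellWalk (Nat.lt_succ_self _)
  have hgood : ∀ᵐ U ∂P, U ∈ goodConfigs d := by
    filter_upwards [hIcc, hne, hwalk] with U h₁ h₂ h₃
    refine ⟨fun e _ => h₁ e, fun e f _ _ hef => not_imp_not.1 (h₂ e f) hef, ?_⟩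
    rintro ⟨w, hadj, hw⟩
    obtain ⟨v, k, h⟩ := exists_hasCellWalk _ (fun e _ => h₁ e) hadj hw
    exact h₃ v k h
  exact (measure_congr (Filter.eventuallyEq_univ.2 hgood)).trans measure_univ

end CDP
end

section
/- For constrained-degree percolation on ℤ^d, d ≥ 2, with κ ∈ {2,…,2d}: for every p ∈ [0,1] and every U ∈ Ω, if U ∈ E_n(p) for all n ≥ 1, then the configuration ω_p(U) contains an infinite p-open cluster. Consequently, for every p with ℙ(⋂_{n≥1} E_n(p)) > 0 one has θ(p) > 0. -/
open MeasureTheory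

namespace CDP

section Konig

variable {α : Type*} {R : α → α → Prop}

/-- Kőnig's lemma: a locally finite relation with infinitely many points reachable from `a` has an
infinite chain starting at `a`. -/
theorem exists_chain_of_infinite_reachable (hfin : ∀ a, {b | R a b}.Finite) {a : α}
    (ha : {b | Relation.ReflTransGen R a b}.Infinite) :
    ∃ f : ℕ → α, f 0 = a ∧ ∀ n, R (f n) (f (n + 1)) := by
  have step : ∀ v : {v // {b | Relation.ReflTransGen R v b}.Infinite},
      ∃ w : {w // {b | Relation.ReflTransGen R w b}.Infinite}, R v w := by
    rintro ⟨v, hv⟩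
    by_contra! h
    refine hv ((((hfin v).biUnion fun w hw => ?_).insert v).subset ?_
      (s := insert v (⋃ w ∈ {w | R v w}, {b | Relation.ReflTransGen R w b})))
    · by_contra hw'
      exact h ⟨w, hw'⟩ hw
    · intro b hb
      rcases Relation.ReflTransGen.cases_head hb with rfl | ⟨w, hw, hwb⟩
      · exact Set.mem_insert _ _
      · exact Set.mem_insert_of_mem _ (Set.mem_biUnion hw hwb)
  choose g hg using step
  refine ⟨fun n => g^[n] ⟨a, ha⟩, rfl, fun n => ?_⟩
  simp only [Function.iterate_succ_apply']
  exact hg _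

end Konig

section Lemmas

variable {d κ : ℕ} {U : Config d} {p : ℝ}

theorem adj.symm {x y : Vertex d} (h : adj x y) : adj y x := by
  unfold adj at *
  simpa only [abs_sub_comm] using h

theorem isNNEdge_mk {x y : Vertex d} : IsNNEdge s(x, y) ↔ adj x y := by
  refine ⟨?_, fun h => ⟨x, y, h, rfl⟩⟩
  rintro ⟨a, b, h, he⟩
  rcases Sym2.eq_iff.1 he with ⟨rfl, rfl⟩ | ⟨rfl, rfl⟩
  exacts [h, h.symm]

theorem finite_setOf_adj (x : Vertex d) : {y | adj x y}.Finite := by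
  refine (Set.finite_Icc (x - 1) (x + 1)).subset fun y hy => ?_
  have hle : ∀ i, |x i - y i| ≤ 1 := fun i =>
    (Finset.single_le_sum (f := fun i => |x i - y i|) (fun _ _ => abs_nonneg _)
      (Finset.mem_univ i)).trans_eq hy
  refine ⟨fun i => ?_, fun i => ?_⟩ <;>
  · have := abs_le.1 (hle i)
    simp only [Pi.sub_apply, Pi.add_apply, Pi.one_apply]
    omega

/-- One step of an increasing walk; a state is the current vertex with the label of the last edge
crossed. -/
def IncStep (U : Config d) (s t : Vertex d × ℝ) : Prop :=
  adj s.1 t.1 ∧ t.2 = U s(s.1, t.1) ∧ s.2 < t.2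

theorem finite_setOf_incStep (s : Vertex d × ℝ) : {t | IncStep U s t}.Finite := by
  refine ((finite_setOf_adj s.1).image fun y => (y, U s(s.1, y))).subset ?_
  rintro ⟨y, r⟩ ⟨h, hr, -⟩
  exact ⟨y, h, Prod.ext rfl hr.symm⟩

theorem finite_reachable_incStep (hU : U ∈ goodConfigs d) (s : Vertex d × ℝ) :
    {t | Relation.ReflTransGen (IncStep U) s t}.Finite := by
  by_contra h
  obtain ⟨f, -, hf⟩ := exists_chain_of_infinite_reachable finite_setOf_incStep h
  refine hU.2.2 ⟨fun n => (f n).1, fun n => (hf n).1, Or.inl (strictMono_nat_of_lt_succ fun n => ?_)⟩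
  simp only [← (hf _).2.1]
  exact (hf (n + 1)).2.2

theorem exists_openConn_of_modifiedOneArm (hU : U ∈ goodConfigs d) {n : ℕ}
    (h : modifiedOneArm κ n p U) :
    ∃ a b, (∃ r, Relation.ReflTransGen (IncStep U) (0, -1) (a, r)) ∧ norm1 b = n ∧
      openConn κ U p a b := by
  obtain ⟨k, x, hpath, hn, -, hk, l, hl, hopen, -, hdec⟩ := h
  refine ⟨x l, x 0, ?_, hn, l, fun i => x (l - i), ⟨fun i hi => ?_, fun i hi j hj hij => ?_⟩,
    by simp, by simp, fun i hi => ?_⟩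
  · have key : ∀ j, j ≤ k - l → ∃ r, Relation.ReflTransGen (IncStep U) (0, -1) (x (k - j), r) ∧
        (r = -1 ∨ 1 ≤ j ∧ r = U s(x (k - j), x (k - j + 1))) := by
      intro j
      induction j with
      | zero => exact fun _ => ⟨-1, by simp [hk, Relation.ReflTransGen.refl], Or.inl rfl⟩
      | succ j ih =>
        intro hj
        obtain ⟨r, hr, hr'⟩ := ih (by omega)
        obtain ⟨m, rfl⟩ : ∃ m, k = m + 1 + j := ⟨k - 1 - j, by omega⟩
        rw [show m + 1 + j - j = m + 1 by omega] at hr hr'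
        rw [show m + 1 + j - (j + 1) = m by omega]
        have hadj : adj (x m) (x (m + 1)) := hpath.1 m (by omega)
        refine ⟨U s(x m, x (m + 1)), hr.tail ⟨hadj.symm, by rw [Sym2.eq_swap], ?_⟩,
          Or.inr ⟨by omega, rfl⟩⟩
        rcases hr' with rfl | ⟨hj1, rfl⟩
        · have := (hU.1 _ (isNNEdge_mk.2 hadj)).1
          simp only
          linarith
        · exact hdec m (by omega) (by omega)
    obtain ⟨r, hr, -⟩ := key (k - l) le_rfl
    exact ⟨r, by rwa [Nat.sub_sub_self hl] at hr⟩
  · have := (hpath.1 (l - (i + 1)) (by omega)).symm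
    rwa [show l - (i + 1) + 1 = l - i by omega] at this
  · have := hpath.2 (l - i) (by omega) (l - j) (by omega) hij
    omega
  · have := hopen (l - (i + 1)) (by omega)
    rwa [show l - (i + 1) + 1 = l - i by omega, Sym2.eq_swap] at this

theorem exists_infinite_cluster (hU : U ∈ goodConfigs d)
    (h : ∀ n : ℕ, 1 ≤ n → modifiedOneArm κ n p U) :
    ∃ a : Vertex d, {b | openConn κ U p a b}.Infinite := by
  by_contra! hfin
  choose a b ha hb hab using fun n : ℕ =>
    exists_openConn_of_modifiedOneArm hU (h (n + 1) (by omega))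
  have hA := (finite_reachable_incStep hU (0, -1)).image Prod.fst
  have hB := hA.biUnion fun v _ => hfin v
  have hinj : Function.Injective b := fun m n hmn => by
    have := hb m
    rw [hmn, hb n] at this
    omega
  refine Set.infinite_of_injective_forall_mem hinj (fun n => ?_) hB
  obtain ⟨r, hr⟩ := ha n
  exact Set.mem_biUnion ⟨_, hr, rfl⟩ (hab n)

/-- The graph of `p`-open edges. -/
def openGraph (κ : ℕ) (U : Config d) (p : ℝ) : SimpleGraph (Vertex d) where
  Adj x y := openEdge κ U p s(x, y)
  symm := ⟨fun x y h => by rwa [Sym2.eq_swap]⟩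
  loopless := ⟨fun x h => by simpa [adj] using isNNEdge_mk.1 h.1⟩

theorem openConn.reachable {a b : Vertex d} (h : openConn κ U p a b) :
    (openGraph κ U p).Reachable a b := by
  obtain ⟨k, x, -, rfl, rfl, hx⟩ := h
  have key : ∀ j ≤ k, (openGraph κ U p).Reachable (x 0) (x j) := by
    intro j
    induction j with
    | zero => exact fun _ => .rfl
    | succ j ih =>
      exact fun hj => (ih (by omega)).trans (SimpleGraph.Adj.reachable (hx j (by omega)))
  exact key k le_rfl

theorem zeroToInf_of_infinite (h : {b | openConn κ U p 0 b}.Infinite) : zeroToInf κ U p := by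
  set G := openGraph κ U p
  let R : Vertex d → Vertex d → Prop := fun v w => G.Adj v w ∧ G.dist 0 w = G.dist 0 v + 1
  have hreach : ∀ n b, G.Reachable 0 b → G.dist 0 b = n → Relation.ReflTransGen R 0 b := by
    intro n
    induction n with
    | zero =>
      intro b hb h0
      rw [hb.dist_eq_zero_iff.1 h0]
    | succ n ih =>
      intro b hb hn
      obtain ⟨q, hq⟩ := hb.symm.exists_walk_length_eq_dist
      rw [SimpleGraph.dist_comm, hn] at hq
      cases q with
      | nil => simp at hq
      | @cons _ c _ hbc q =>
        have h1 : G.dist 0 c ≤ n := by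
          rw [SimpleGraph.dist_comm]
          exact (SimpleGraph.dist_le q).trans (by simpa using hq.le)
        obtain ⟨r, hr⟩ := q.reachable.symm.exists_walk_length_eq_dist
        have h2 := SimpleGraph.dist_le (r.concat hbc.symm)
        rw [SimpleGraph.Walk.length_concat, hr, hn] at h2
        exact (ih c q.reachable.symm (by omega)).tail ⟨hbc.symm, by omega⟩
  obtain ⟨f, hf0, hf⟩ := exists_chain_of_infinite_reachable (R := R) (a := 0)
    (fun v => (finite_setOf_adj v).subset fun w hw => isNNEdge_mk.1 hw.1.1)
    (h.mono fun b hb => hreach _ b hb.reachable rfl)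
  refine ⟨f, hf0, fun i => isNNEdge_mk.1 (hf i).1.1, ?_, fun i => (hf i).1⟩
  have hmono : StrictMono fun n => G.dist 0 (f n) :=
    strictMono_nat_of_lt_succ fun n => by rw [(hf n).2]; exact Nat.lt_succ_self _
  exact fun m n hmn => hmono.injective (congrArg (G.dist 0) hmn)

/-- Translation by `a` acting on pairs of vertices. -/
def edgeShift (a : Vertex d) : Sym2 (Vertex d) ≃ Sym2 (Vertex d) where
  toFun := Sym2.map (· + a)
  invFun := Sym2.map (· - a)
  left_inv e := by induction e; simp
  right_inv e := by induction e; simp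

@[simp] theorem edgeShift_mk (a x y : Vertex d) : edgeShift a s(x, y) = s(x + a, y + a) := rfl

@[simp] theorem adj_add_right (a x y : Vertex d) : adj (x + a) (y + a) ↔ adj x y := by
  simp [adj]

@[simp] theorem isNNEdge_edgeShift (a : Vertex d) (e : Sym2 (Vertex d)) :
    IsNNEdge (edgeShift a e) ↔ IsNNEdge e := by
  induction e
  simp [isNNEdge_mk]

theorem mem_edgeShift (a v : Vertex d) (e : Sym2 (Vertex d)) :
    v ∈ edgeShift a e ↔ v - a ∈ e := by
  induction e
  simp [sub_eq_iff_eq_add]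

/-- The configuration seen from the vertex `a`. -/
def shift (a : Vertex d) (U : Config d) : Config d := fun e => U (edgeShift a e)

theorem shift_mem_goodConfigs (hU : U ∈ goodConfigs d) (a : Vertex d) :
    shift a U ∈ goodConfigs d := by
  refine ⟨fun e he => hU.1 _ (by simpa using he), fun e f he hf hef => (edgeShift a).injective
    (hU.2.1 _ _ (by simpa using he) (by simpa using hf) hef), ?_⟩
  rintro ⟨w, hw, hmono⟩
  exact hU.2.2 ⟨fun i => w i + a, fun i => by simpa using hw i, hmono⟩

theorem Consistent.shift {σ : Sym2 (Vertex d) → Prop} (h : Consistent κ U σ) (a : Vertex d) :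
    Consistent κ (shift a U) (σ ∘ edgeShift a) := by
  intro e he
  refine (h (edgeShift a e) (by simpa using he)).trans ?_
  have hcard : ∀ v, Set.ncard {f : Sym2 (Vertex d) | IsNNEdge f ∧ v + a ∈ f ∧
        f ≠ edgeShift a e ∧ U f < U (edgeShift a e) ∧ σ f} =
      Set.ncard {f : Sym2 (Vertex d) | IsNNEdge f ∧ v ∈ f ∧ f ≠ e ∧
        CDP.shift a U f < CDP.shift a U e ∧ (σ ∘ edgeShift a) f} := by
    intro v
    refine Eq.trans ?_ (Set.ncard_image_of_injective _ (edgeShift a).injective)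
    congr 1
    ext f
    obtain ⟨f, rfl⟩ := (edgeShift a).surjective f
    simp [mem_edgeShift, CDP.shift]
  refine ⟨fun H v hv => ?_, fun H v hv => ?_⟩
  · rw [← hcard]
    exact H _ (by simpa [mem_edgeShift] using hv)
  · have := H _ ((mem_edgeShift a v e).1 hv)
    rwa [← hcard, sub_add_cancel] at this

theorem openEdge.shift {a : Vertex d} {e : Sym2 (Vertex d)}
    (h : openEdge κ U p (edgeShift a e)) : openEdge κ (shift a U) p e := by
  obtain ⟨he, hp, σ, hσ, hσe⟩ := h
  exact ⟨by simpa using he, hp, _, hσ.shift a, hσe⟩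

theorem openConn.shift {a b : Vertex d} (h : openConn κ U p a b) :
    openConn κ (shift a U) p 0 (b - a) := by
  obtain ⟨k, x, ⟨hadj, hinj⟩, h0, hk, hx⟩ := h
  refine ⟨k, fun i => x i - a, ⟨fun i hi => ?_, fun i hi j hj hij => ?_⟩, by simp [h0],
    by simp [hk], fun i hi => openEdge.shift ?_⟩
  · rw [← adj_add_right a]
    simpa using hadj i hi
  · exact hinj i hi j hj (sub_left_injective hij)
  · simpa using hx i hi

theorem measurable_shift (a : Vertex d) : Measurable (shift a : Config d → Config d) :=
  measurable_pi_lambda _ fun _ => measurable_pi_apply _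

theorem IsProductUniform.eq_infinitePi {P : Measure (Config d)} (hP : IsProductUniform P)
    [IsProbabilityMeasure (volume.restrict (Set.Icc (0 : ℝ) 1))] :
    P = Measure.infinitePi fun _ => volume.restrict (Set.Icc (0 : ℝ) 1) := by
  refine Measure.eq_infinitePi _ fun s t ht => (hP.2 s t fun e _ => ht e).trans ?_
  exact Finset.prod_congr rfl fun e _ => (Measure.restrict_apply (ht e)).symm

theorem IsProductUniform.map_shift {P : Measure (Config d)} (hP : IsProductUniform P)
    (a : Vertex d) : IsProductUniform (P.map (shift a)) := by
  have := hP.1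
  refine ⟨Measure.isProbabilityMeasure_map (measurable_shift a).aemeasurable, fun s f hf => ?_⟩
  have hmeas : MeasurableSet {U : Config d | ∀ e ∈ s, U e ∈ f e} :=
    MeasurableSet.pi s.countable_toSet hf
  rw [Measure.map_apply (measurable_shift a) hmeas]
  have := hP.2 (s.map (edgeShift a).toEmbedding) (fun e => f ((edgeShift a).symm e))
    (fun e he => hf _ (by simpa using he))
  refine (congrArg P (Set.ext fun U => ?_)).trans (this.trans (by simp))
  rw [Set.mem_ofPred_eq, Finset.forall_mem_map]
  simp [CDP.shift]

theorem IsProductUniform.map_shift_eq {P : Measure (Config d)} (hP : IsProductUniform P)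
    (a : Vertex d) : P.map (shift a) = P := by
  have : IsProbabilityMeasure (volume.restrict (Set.Icc (0 : ℝ) 1)) := ⟨by simp⟩
  rw [(hP.map_shift a).eq_infinitePi, ← hP.eq_infinitePi]

theorem thetaInf_pos_of_infinite_cluster {P : Measure (Config d)} (hP : IsProductUniform P)
    (h : 0 < P {U | U ∈ goodConfigs d ∧ ∃ a, {b | openConn κ U p a b}.Infinite}) :
    0 < thetaInf κ P p := by
  have := hP.1
  refine ENNReal.toReal_pos (fun h0 => h.ne' ?_) (measure_ne_top _ _)
  refine measure_mono_null (t := ⋃ a : Vertex d,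
    shift a ⁻¹' {U | U ∈ goodConfigs d ∧ zeroToInf κ U p}) ?_ (measure_iUnion_null fun a => ?_)
  · rintro U ⟨hU, a, ha⟩
    refine Set.mem_iUnion.2 ⟨a, shift_mem_goodConfigs hU a, zeroToInf_of_infinite ?_⟩
    refine (ha.image (sub_left_injective (b := a)).injOn).mono ?_
    rintro _ ⟨b, hb, rfl⟩
    exact hb.shift
  · refine le_antisymm ((Measure.le_map_apply (measurable_shift a).aemeasurable _).trans ?_) zero_le
    rw [hP.map_shift_eq a, h0]

end Lemmas

/-- If `U ∈ Ω` lies in `E_n(p)` for all `n ≥ 1`, then `ω_p(U)` contains an infinite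
`p`-open cluster; consequently, if `ℙ(⋂_{n ≥ 1} E_n(p)) > 0` then `θ(p) > 0`. -/
theorem infinite_cluster_from_all_arms (d κ : ℕ) (hd : 2 ≤ d) (hκ₁ : 2 ≤ κ) (hκ₂ : κ ≤ 2 * d)
    (P : Measure (Config d)) (hP : IsProductUniform P) (p : ℝ) (hp : p ∈ Set.Icc (0 : ℝ) 1) :
    (∀ U ∈ goodConfigs d, (∀ n : ℕ, 1 ≤ n → modifiedOneArm κ n p U) →
      ∃ a : Vertex d, {b | openConn κ U p a b}.Infinite) ∧
    (0 < P {U | U ∈ goodConfigs d ∧ ∀ n : ℕ, 1 ≤ n → modifiedOneArm κ n p U} →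
      0 < thetaInf κ P p) := by
  exact ⟨fun _ => exists_infinite_cluster, fun h => thetaInf_pos_of_infinite_cluster hP
    (h.trans_le (measure_mono fun _ hU => ⟨hU.1, exists_infinite_cluster hU.1 hU.2⟩))⟩

end CDP
end
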